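/- There exists a natural number D and an absolute constant K ≥ 1 such that for every real R ≥ 2 there exist a map Φ: B_Γ(0,R) → ℝ^D and a constant c > 0 with c·d(γ,γ') ≤ |Φ(γ) − Φ(γ')| ≤ c·K·(log R)^{1/2}·d(γ,γ') for all γ, γ' ∈ B_Γ(0,R). That is, the discrete ball of radius R in the integer Heisenberg lattice, with the Carnot–Carathéodory metric, embeds into a bounded-dimensional Euclidean space with distortion O((log R)^{1/2}). -/

import Mathlib

open scoped ENNReal NNReal RealInnerProductSpace BigOperators

noncomputable section

/-- The Heisenberg group `H`, identified as a set with `ℝ³`. -/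
abbrev H : Type := ℝ × ℝ × ℝ

namespace Heisenberg

/-- The group law `[a,b,c]·[x,y,z] = [x+a, y+b, z+c+a·y]`. -/
def mul (p q : H) : H := (q.1 + p.1, q.2.1 + p.2.1, q.2.2 + p.2.2 + p.1 * q.2.1)

/-- The group inverse `[x,y,z]⁻¹ = [−x,−y,−z+xy]`. -/
def inv (p : H) : H := (-p.1, -p.2.1, -p.2.2 + p.1 * p.2.1)

/-- Membership in the integer lattice `Γ`. -/
def inGamma (p : H) : Prop :=
  (∃ a : ℤ, p.1 = (a : ℝ)) ∧ (∃ b : ℤ, p.2.1 = (b : ℝ)) ∧ (∃ c : ℤ, p.2.2 = (c : ℝ))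

/-- Flow along the vector field `X`: `exp(tX)[x,y,z] = [x+t, y, z+t·y]`. -/
def flowX (t : ℝ) (p : H) : H := (p.1 + t, p.2.1, p.2.2 + t * p.2.1)

/-- Flow along the vector field `Y`: `exp(tY)[x,y,z] = [x, y+t, z]`. -/
def flowY (t : ℝ) (p : H) : H := (p.1, p.2.1 + t, p.2.2)

def flow : Bool → ℝ → H → H
  | true => flowX
  | false => flowY

/-- `applyFlows [(W₁,t₁),…,(W_k,t_k)] p = exp(t₁W₁)⋯exp(t_kW_k) p`. -/
def applyFlows : List (Bool × ℝ) → H → H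
  | [], p => p
  | wt :: l, p => flow wt.1 wt.2 (applyFlows l p)

/-- The Carnot–Carathéodory metric on `H`. -/
def ccDist (p p' : H) : ℝ :=
  sInf { s | ∃ l : List (Bool × ℝ), applyFlows l p = p' ∧ s = (l.map fun wt => |wt.2|).sum }

/-- The parabolic dilation `δ_λ[x,y,z] = [λx, λy, λ²z]`. -/
def dilate (lam : ℝ) (p : H) : H := (lam * p.1, lam * p.2.1, lam ^ 2 * p.2.2)

variable {E : Type*} [NormedAddCommGroup E] [NormedSpace ℝ E]

/-- The right-invariant vector field `X = ∂/∂x + y ∂/∂z` acting on functions. -/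
def XD (φ : H → E) : H → E := fun p => fderiv ℝ φ p (1, 0, p.2.1)

/-- The right-invariant vector field `Y = ∂/∂y` acting on functions. -/
def YD (φ : H → E) : H → E := fun p => fderiv ℝ φ p (0, 1, 0)

/-- The vector field `Z = ∂/∂z` acting on functions. -/
def ZD (φ : H → E) : H → E := fun p => fderiv ℝ φ p (0, 0, 1)

def WD : Bool → (H → E) → H → E
  | true => XD
  | false => YD

/-- `X`, `Y`, `Z` indexed by `Fin 3`. -/
def WD3 : Fin 3 → (H → E) → H → E := ![XD, YD, ZD]

/-- The pointwise (Euclidean) norm `|∇^j φ(p)|` of the `j`-th iterated horizontal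
gradient `∇^jφ`, computed via the words of length `j` in `X, Y`. -/
def gradNorm (j : ℕ) (φ : H → E) (p : H) : ℝ :=
  Real.sqrt (∑ w : Fin j → Bool, ‖(List.ofFn w).foldr WD φ p‖ ^ 2)

/-- `‖∇^m φ‖_{C^k_R}`, valued in `ℝ≥0∞`. -/
def CkRS (m k : ℕ) (R : ℝ) (φ : H → E) : ℝ≥0∞ :=
  ∑ j ∈ Finset.range (k + 1),
    ENNReal.ofReal (R ^ j) * ⨆ p : H, ENNReal.ofReal (gradNorm (m + j) φ p)

/-- The homogeneous Hölder seminorm `‖∇^m φ‖_{Ċ^{0,α}}`, valued in `ℝ≥0∞`. -/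
def gradHolderS (m : ℕ) (α : ℝ) (φ : H → E) : ℝ≥0∞ :=
  ⨆ (p : H) (q : H) (_ : p ≠ q),
    ENNReal.ofReal (Real.sqrt (∑ w : Fin m → Bool,
        ‖(List.ofFn w).foldr WD φ p - (List.ofFn w).foldr WD φ q‖ ^ 2)) /
      ENNReal.ofReal (ccDist p q ^ α)

/-- `‖∇^m φ‖_{C^{k,α}_R}`, valued in `ℝ≥0∞`. -/
def CkAS (m k : ℕ) (α R : ℝ) (φ : H → E) : ℝ≥0∞ :=
  CkRS m k R φ + ENNReal.ofReal (R ^ ((k : ℝ) + α)) * gradHolderS (m + k) α φ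

/-- `‖φ‖_{C^k_R}`. -/
abbrev CkR (k : ℕ) (R : ℝ) (φ : H → E) : ℝ≥0∞ := CkRS 0 k R φ

/-- `‖φ‖_{C^{k,α}_R}`. -/
abbrev CkA (k : ℕ) (α R : ℝ) (φ : H → E) : ℝ≥0∞ := CkAS 0 k α R φ

/-- A dyadic number is one of the form `2^m`, `m ∈ ℤ`. -/
def IsDyadic (A : ℝ) : Prop := ∃ m : ℤ, A = 2 ^ m

/-- The norm `|v₁ ∧ ⋯ ∧ v_k|` of a wedge product of vectors of `ℝ^D`, via the
Cauchy–Binet (Gram determinant) formula. -/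
def wedgeNorm {D k : ℕ} (v : Fin k → EuclideanSpace ℝ (Fin D)) : ℝ :=
  Real.sqrt (Matrix.det (Matrix.of fun i j => ⟪v i, v j⟫))

end Heisenberg

open Heisenberg

namespace Heisenberg

/-- The length of a horizontal path consisting of finitely many flow segments. -/
def pathLength (l : List (Bool × ℝ)) : ℝ := (l.map fun wt => |wt.2|).sum

@[simp] lemma pathLength_nil : pathLength [] = 0 := rfl

@[simp] lemma pathLength_cons (wt : Bool × ℝ) (l : List (Bool × ℝ)) :
    pathLength (wt :: l) = |wt.2| + pathLength l := by
  simp [pathLength]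

lemma pathLength_nonneg (l : List (Bool × ℝ)) : 0 ≤ pathLength l := by
  induction l with
  | nil => simp
  | cons wt l ih => rw [pathLength_cons]; positivity

@[simp] lemma flow_zero (b : Bool) (p : H) : flow b 0 p = p := by
  cases b <;> simp [flow, flowX, flowY]

lemma flow_flow (b : Bool) (s t : ℝ) (p : H) : flow b s (flow b t p) = flow b (t + s) p := by
  cases b <;> refine Prod.ext ?_ (Prod.ext ?_ ?_) <;> simp only [flow, flowX, flowY] <;> ring

lemma ccDist_le_pathLength (l : List (Bool × ℝ)) (p : H) :
    ccDist p (applyFlows l p) ≤ pathLength l := by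
  refine csInf_le ⟨0, ?_⟩ ⟨l, rfl, rfl⟩
  rintro s ⟨l', -, rfl⟩
  exact pathLength_nonneg l'

/-- A horizontal path joining two points, whose length is controlled by the parabolic size of the
displacement. -/
lemma exists_path_le {p q : H} {r a b : ℝ} (hr : 0 < r) (h1 : |q.1 - p.1| ≤ r * a)
    (h2 : |q.2.1 - p.2.1| ≤ r * a) (h3 : |q.2.2 - p.2.2 - (q.1 - p.1) * p.2.1| ≤ r ^ 2 * b) :
    ∃ l, applyFlows l p = q ∧ pathLength l ≤ r * (2 * a + 2 + 2 * b) := by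
  set w := q.2.2 - p.2.2 - (q.1 - p.1) * p.2.1 with hw
  refine ⟨[(true, r), (false, w / r), (true, -r), (false, -(w / r)), (false, q.2.1 - p.2.1),
    (true, q.1 - p.1)], ?_, ?_⟩
  · obtain ⟨q1, q2, q3⟩ := q
    simp only [applyFlows, flow, flowX, flowY, Prod.mk.injEq]
    refine ⟨by ring, by ring, ?_⟩
    have : r * (w / r) = w := by field_simp
    simp only at hw
    linear_combination this + hw
  · have h4 : |w / r| ≤ r * b := by
      rw [abs_div, abs_of_pos hr, div_le_iff₀ hr]
      linarith
    simp only [pathLength_cons, pathLength_nil, abs_neg, abs_of_pos hr]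
    linarith

lemma exists_path (p q : H) : ∃ l, applyFlows l p = q := by
  obtain ⟨l, hl, -⟩ := exists_path_le (p := p) (q := q) (r := 1)
    (a := max |q.1 - p.1| |q.2.1 - p.2.1|) one_pos (by simp) (by simp) (by rw [one_pow, one_mul])
  exact ⟨l, hl⟩

lemma exists_path_lt {p q : H} {s : ℝ} (h : ccDist p q < s) :
    ∃ l, applyFlows l p = q ∧ pathLength l < s := by
  obtain ⟨l₀, hl₀⟩ := exists_path p q
  have hne : {s | ∃ l, applyFlows l p = q ∧ s = pathLength l}.Nonempty := ⟨_, l₀, hl₀, rfl⟩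
  obtain ⟨_, ⟨l, hl, rfl⟩, hs⟩ := exists_lt_of_csInf_lt hne h
  exact ⟨l, hl, hs⟩

lemma ccDist_nonneg (p q : H) : 0 ≤ ccDist p q := by
  refine Real.sInf_nonneg ?_
  rintro s ⟨l, -, rfl⟩
  exact pathLength_nonneg l

/-- The end point of a short horizontal path is parabolically close to its starting point. -/
lemma applyFlows_displacement (l : List (Bool × ℝ)) (p : H) :
    |(applyFlows l p).1 - p.1| ≤ pathLength l ∧ |(applyFlows l p).2.1 - p.2.1| ≤ pathLength l ∧
      |(applyFlows l p).2.2 - p.2.2 - ((applyFlows l p).1 - p.1) * p.2.1| ≤ pathLength l ^ 2 := by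
  induction l with
  | nil => simp [applyFlows]
  | cons wt l ih =>
    obtain ⟨b, t⟩ := wt
    obtain ⟨h1, h2, h3⟩ := ih
    have hl := pathLength_nonneg l
    have ht := abs_nonneg t
    simp only [applyFlows, pathLength_cons]
    generalize applyFlows l p = q at *
    cases b
    · simp only [flow, flowY]
      refine ⟨by linarith, ?_, by nlinarith⟩
      calc |q.2.1 + t - p.2.1| = |(q.2.1 - p.2.1) + t| := by congr 1; ring
        _ ≤ _ := (abs_add_le _ _).trans (by linarith)
    · simp only [flow, flowX]
      refine ⟨?_, by linarith, ?_⟩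
      · calc |q.1 + t - p.1| = |(q.1 - p.1) + t| := by congr 1; ring
          _ ≤ _ := (abs_add_le _ _).trans (by linarith)
      · calc |q.2.2 + t * q.2.1 - p.2.2 - (q.1 + t - p.1) * p.2.1|
            = |(q.2.2 - p.2.2 - (q.1 - p.1) * p.2.1) + t * (q.2.1 - p.2.1)| := by congr 1; ring
          _ ≤ |q.2.2 - p.2.2 - (q.1 - p.1) * p.2.1| + |t| * |q.2.1 - p.2.1| := by
            rw [← abs_mul]; exact abs_add_le _ _
          _ ≤ _ := by nlinarith

/-- Distinct lattice points are at distance at least `1/2`. -/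
lemma half_le_ccDist {p q : H} (hp : inGamma p) (hq : inGamma q) (hpq : p ≠ q) :
    1 / 2 ≤ ccDist p q := by
  by_contra! h
  obtain ⟨l, rfl, hl⟩ := exists_path_lt h
  obtain ⟨h1, h2, h3⟩ := applyFlows_displacement l p
  have hl0 := pathLength_nonneg l
  have key : ∀ {x y : ℝ}, (∃ m : ℤ, x = m) → (∃ m : ℤ, y = m) → |y - x| ≤ 1 / 2 → x = y := by
    rintro _ _ ⟨m, rfl⟩ ⟨k, rfl⟩ hmk
    have : |k - m| < 1 := by
      have : |(k : ℝ) - m| < 1 := by linarith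
      exact_mod_cast this
    rw [Int.abs_lt_one_iff] at this
    rw [show k = m by lia]
  have e1 := key hp.1 hq.1 (by linarith)
  have e2 := key hp.2.1 hq.2.1 (by linarith)
  rw [← e1, sub_self, zero_mul, sub_zero] at h3
  have e3 := key hp.2.2 hq.2.2 (by nlinarith)
  exact hpq (Prod.ext e1 (Prod.ext e2 e3))

lemma abs_le_of_ccDist_zero_lt {p : H} {R : ℝ} (h : ccDist 0 p < R) :
    |p.1| ≤ R ∧ |p.2.1| ≤ R ∧ |p.2.2| ≤ R ^ 2 := by
  obtain ⟨l, rfl, hl⟩ := exists_path_lt h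
  obtain ⟨h1, h2, h3⟩ := applyFlows_displacement l 0
  have hl0 := pathLength_nonneg l
  simp only [Prod.fst_zero, Prod.snd_zero, sub_zero, mul_zero] at h1 h2 h3
  exact ⟨by linarith, by linarith, by nlinarith⟩

lemma ccDist_le_of_mem_ball {p q : H} {R : ℝ} (hp : ccDist 0 p < R) (hq : ccDist 0 q < R) :
    ccDist p q ≤ 14 * R := by
  have hR : 0 < R := (ccDist_nonneg _ _).trans_lt hp
  obtain ⟨p1, p2, p3⟩ := abs_le_of_ccDist_zero_lt hp
  obtain ⟨q1, q2, q3⟩ := abs_le_of_ccDist_zero_lt hq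
  have d1 : |q.1 - p.1| ≤ R * 2 := (abs_sub _ _).trans (by linarith)
  have d2 : |q.2.1 - p.2.1| ≤ R * 2 := (abs_sub _ _).trans (by linarith)
  have d3 : |q.2.2 - p.2.2 - (q.1 - p.1) * p.2.1| ≤ R ^ 2 * 4 := by
    refine (abs_sub _ _).trans ?_
    rw [abs_mul]
    have := abs_sub q.2.2 p.2.2
    have := mul_le_mul d1 p2 (abs_nonneg _) (by positivity)
    linarith
  obtain ⟨l, rfl, hl⟩ := exists_path_le hR d1 d2 d3
  exact (ccDist_le_pathLength l p).trans (by linarith)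

lemma finite_ball (R : ℝ) : {p : H | inGamma p ∧ ccDist 0 p < R}.Finite := by
  refine ((((Set.finite_Icc (-⌈R⌉) ⌈R⌉).prod ((Set.finite_Icc (-⌈R⌉) ⌈R⌉).prod
    (Set.finite_Icc (-⌈R ^ 2⌉) ⌈R ^ 2⌉)))).image
    (fun γ : ℤ × ℤ × ℤ => ((γ.1 : ℝ), (γ.2.1 : ℝ), (γ.2.2 : ℝ)))).subset ?_
  rintro ⟨x, y, z⟩ ⟨⟨⟨a, rfl : x = a⟩, ⟨b, rfl : y = b⟩, ⟨c, rfl : z = c⟩⟩, hp⟩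
  obtain ⟨p1, p2, p3⟩ := abs_le_of_ccDist_zero_lt hp
  have key : ∀ {k : ℤ} {s : ℝ}, |(k : ℝ)| ≤ s → k ∈ Set.Icc (-⌈s⌉) ⌈s⌉ := by
    intro k s hk
    have hs := hk.trans (Int.le_ceil s)
    rw [Set.mem_Icc, ← abs_le]
    exact_mod_cast hs
  exact ⟨(a, b, c), ⟨key p1, key p2, key p3⟩, rfl⟩

section Calculus

variable {E : Type*} [NormedAddCommGroup E]

/-- `f` is Lipschitz along the flows of `X` and `Y`. -/
def FlowLipschitz (L : ℝ) (f : H → E) : Prop :=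
  ∀ b t p, ‖f (flow b t p) - f p‖ ≤ L * |t|

lemma FlowLipschitz.mono {L L' : ℝ} {f : H → E} (h : FlowLipschitz L f) (hL : L ≤ L') :
    FlowLipschitz L' f :=
  fun b t p => (h b t p).trans (by gcongr)

lemma FlowLipschitz.norm_applyFlows_sub_le {L : ℝ} {f : H → E} (h : FlowLipschitz L f)
    (l : List (Bool × ℝ)) (p : H) : ‖f (applyFlows l p) - f p‖ ≤ L * pathLength l := by
  induction l with
  | nil => simp [applyFlows]
  | cons wt l ih =>
    rw [pathLength_cons, mul_add]
    exact (norm_sub_le_norm_sub_add_norm_sub _ (f (applyFlows l p)) _).trans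
      (add_le_add (h _ _ _) ih)

lemma FlowLipschitz.norm_sub_le {L : ℝ} {f : H → E} (h : FlowLipschitz L f) (hL : 0 ≤ L)
    (p q : H) : ‖f p - f q‖ ≤ L * ccDist p q := by
  refine le_of_forall_pos_le_add fun ε hε => ?_
  obtain ⟨l, rfl, hl⟩ := exists_path_lt (p := p) (q := q)
    (lt_add_of_pos_right _ (show 0 < ε / (L + 1) by positivity))
  rw [norm_sub_rev]
  refine (h.norm_applyFlows_sub_le l p).trans ?_
  have h1 : L * (ε / (L + 1)) ≤ ε := by
    rw [mul_div_assoc', div_le_iff₀ (by positivity)]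
    nlinarith
  have := mul_le_mul_of_nonneg_left hl.le hL
  linarith

variable [NormedSpace ℝ E]

/-- `f' true` and `f' false` are the derivatives of `f` along `X` and `Y`. -/
def HasFlowDeriv (f : H → E) (f' : Bool → H → E) : Prop :=
  ∀ b p, HasDerivAt (fun t => f (flow b t p)) (f' b p) 0

lemma HasFlowDeriv.hasDerivAt {f : H → E} {f' : Bool → H → E} (h : HasFlowDeriv f f') (b : Bool)
    (p : H) (t : ℝ) : HasDerivAt (fun s => f (flow b s p)) (f' b (flow b t p)) t := by
  have h' := h b (flow b t p)
  rw [← sub_self t] at h'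
  simpa [flow_flow] using h'.comp_sub_const t t

/-- The mean value inequality along a single flow line. -/
lemma HasFlowDeriv.norm_flow_sub_le {f : H → E} {f' : Bool → H → E} (h : HasFlowDeriv f f')
    {b : Bool} {t C : ℝ} {p : H} (hC : ∀ s, |s| ≤ |t| → ‖f' b (flow b s p)‖ ≤ C) :
    ‖f (flow b t p) - f p‖ ≤ C * |t| := by
  have := (convex_Icc (-|t|) |t|).norm_image_sub_le_of_norm_hasDerivWithin_le
    (f := fun s => f (flow b s p)) (f' := fun s => f' b (flow b s p)) (C := C) (x := 0) (y := t)
    (fun s _ => (h.hasDerivAt b p s).hasDerivWithinAt) (fun s hs => hC s (abs_le.2 hs))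
    ⟨by simp, by simp⟩ (abs_le.1 le_rfl)
  simpa using this

lemma HasFlowDeriv.flowLipschitz {f : H → E} {f' : Bool → H → E} (h : HasFlowDeriv f f')
    {C : ℝ} (hC : ∀ b p, ‖f' b p‖ ≤ C) : FlowLipschitz C f :=
  fun b _ _ => h.norm_flow_sub_le fun _ _ => hC b _

end Calculus

section Bump

lemma hasDerivAt_flow (b : Bool) (p : H) :
    HasDerivAt (fun t => flow b t p) (if b then (1, 0, p.2.1) else (0, 1, 0)) 0 := by
  have h : ∀ u : ℝ, HasDerivAt (fun t : ℝ => u + t) 1 0 := fun u => (hasDerivAt_id 0).const_add u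
  cases b
  · exact (hasDerivAt_const _ _).prodMk ((h _).prodMk (hasDerivAt_const _ _))
  · refine (h _).prodMk ((hasDerivAt_const _ _).prodMk ?_)
    simpa using ((hasDerivAt_id (0 : ℝ)).mul_const p.2.1).const_add p.2.2

lemma hasFlowDeriv_WD {φ : H → ℝ} (h : Differentiable ℝ φ) :
    HasFlowDeriv φ fun b => WD b φ := by
  intro b p
  have h1 : HasFDerivAt φ (fderiv ℝ φ p) (flow b 0 p) := by
    rw [flow_zero]
    exact (h p).hasFDerivAt
  have := h1.comp_hasDerivAt (0 : ℝ) (hasDerivAt_flow b p)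
  cases b <;> exact this

lemma contDiff_WD {φ : H → ℝ} {m n : WithTop ℕ∞} (h : ContDiff ℝ n φ) (hmn : m + 1 ≤ n)
    (b : Bool) : ContDiff ℝ m (WD b φ) := by
  have h1 := h.fderiv_right hmn
  cases b
  · exact h1.clm_apply contDiff_const
  · exact h1.clm_apply (contDiff_const.prodMk (contDiff_const.prodMk contDiff_snd.fst))

lemma support_WD_subset (φ : H → ℝ) (b : Bool) : Function.support (WD b φ) ⊆ tsupport φ := by
  intro p hp
  refine support_fderiv_subset ℝ (f := φ) ?_
  rw [Function.mem_support] at hp ⊢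
  intro h
  cases b <;> simp [WD, XD, YD, h] at hp

lemma hasCompactSupport_WD {φ : H → ℝ} (h : HasCompactSupport φ) (b : Bool) :
    HasCompactSupport (WD b φ) :=
  h.mono' (support_WD_subset φ b)

/-- A bump function adapted to the unit tile, with two bounded horizontal derivatives. -/
structure IsBump (K : ℝ) (χ : H → ℝ) (χ' : Bool → H → ℝ) : Prop where
  one_le : 1 ≤ K
  abs_le : ∀ p, |χ p| ≤ K
  eq_one : ∀ p, ‖p‖ ≤ 1 → χ p = 1
  norm_le : ∀ p, χ p ≠ 0 → ‖p‖ ≤ 2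
  abs_deriv_le : ∀ b p, |χ' b p| ≤ K
  norm_le_deriv : ∀ b p, χ' b p ≠ 0 → ‖p‖ ≤ 2
  hasFlowDeriv : HasFlowDeriv χ χ'
  flowLipschitz : ∀ b, FlowLipschitz K (χ' b)

lemma exists_isBump : ∃ K χ χ', IsBump K χ χ' := by
  let β : ContDiffBump (0 : H) := ⟨1, 2, one_pos, one_lt_two⟩
  have hβ : ContDiff ℝ 2 β := β.contDiff
  have hc : HasCompactSupport β := β.hasCompactSupport
  have hβ' : ∀ b, ContDiff ℝ 1 (WD b β) := contDiff_WD hβ (by norm_num [one_add_one_eq_two])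
  have hβ'' : ∀ b b', ContDiff ℝ 0 (WD b' (WD b β)) := fun b => contDiff_WD (hβ' b) (by simp)
  obtain ⟨K₀, hK₀⟩ := hc.exists_bound_of_continuous hβ.continuous
  choose K₁ hK₁ using fun b =>
    (hasCompactSupport_WD hc b).exists_bound_of_continuous (hβ' b).continuous
  choose K₂ hK₂ using fun b b' =>
    (hasCompactSupport_WD (hasCompactSupport_WD hc b) b').exists_bound_of_continuous
      (hβ'' b b').continuous
  have nonneg₀ : 0 ≤ K₀ := (norm_nonneg _).trans (hK₀ 0)
  have nonneg₁ : ∀ b, 0 ≤ K₁ b := fun b => (norm_nonneg _).trans (hK₁ b 0)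
  have nonneg₂ : ∀ b b', 0 ≤ K₂ b b' := fun b b' => (norm_nonneg _).trans (hK₂ b b' 0)
  have sum₁ : ∀ b, K₁ b ≤ ∑ b, K₁ b := fun b =>
    Finset.single_le_sum (fun b _ => nonneg₁ b) (Finset.mem_univ b)
  have sum₂ : ∀ b b', K₂ b b' ≤ ∑ b, ∑ b', K₂ b b' := fun b b' =>
    (Finset.single_le_sum (fun b' _ => nonneg₂ b b') (Finset.mem_univ b')).trans
      (Finset.single_le_sum (f := fun b => ∑ b', K₂ b b')
        (fun b _ => Finset.sum_nonneg fun b' _ => nonneg₂ b b') (Finset.mem_univ b))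
  have sum₁_nonneg : 0 ≤ ∑ b, K₁ b := (nonneg₁ true).trans (sum₁ true)
  have sum₂_nonneg : 0 ≤ ∑ b, ∑ b', K₂ b b' := (nonneg₂ true true).trans (sum₂ true true)
  refine ⟨1 + K₀ + ∑ b, K₁ b + ∑ b, ∑ b', K₂ b b', β, fun b => WD b β, ?_⟩
  constructor
  · linarith
  · intro p
    have := hK₀ p
    rw [Real.norm_eq_abs] at this
    linarith
  · intro p hp
    exact β.one_of_mem_closedBall (by simpa using hp)
  · intro p hp
    have : p ∈ Metric.ball (0 : H) 2 := by
      rw [← β.support_eq]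
      exact hp
    exact (mem_ball_zero_iff.1 this).le
  · intro b p
    have := hK₁ b p
    have := sum₁ b
    rw [Real.norm_eq_abs] at *
    linarith
  · intro b p hp
    have := support_WD_subset β b hp
    rw [β.tsupport_eq] at this
    simpa using this
  · exact hasFlowDeriv_WD (hβ.differentiable (by norm_num))
  · intro b
    refine (hasFlowDeriv_WD ((hβ' b).differentiable (by norm_num))).flowLipschitz fun b' p => ?_
    have := hK₂ b b' p
    have := sum₂ b b'
    linarith

end Bump

section Chart

/-- Rescaled coordinates of `p` on the tile of scale `r` indexed by the lattice point `γ`. -/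
def chart (r : ℝ) (γ : ℤ × ℤ × ℤ) (p : H) : H :=
  mul (dilate r⁻¹ p) (inv ((γ.1 : ℝ), (γ.2.1 : ℝ), (γ.2.2 : ℝ)))

lemma chart_flow (r : ℝ) (γ : ℤ × ℤ × ℤ) (b : Bool) (t : ℝ) (p : H) :
    chart r γ (flow b t p) = flow b (r⁻¹ * t) (chart r γ p) := by
  cases b <;> refine Prod.ext ?_ (Prod.ext ?_ ?_) <;>
    simp only [chart, mul, dilate, inv, flow, flowX, flowY] <;> ring

lemma norm_le_iff {p : H} {s : ℝ} : ‖p‖ ≤ s ↔ |p.1| ≤ s ∧ |p.2.1| ≤ s ∧ |p.2.2| ≤ s := by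
  simp [Prod.norm_def]

/-- Every point lies in the tile of some lattice point. -/
lemma exists_norm_chart_le_one (r : ℝ) (p : H) : ∃ γ, ‖chart r γ p‖ ≤ 1 := by
  have key : ∀ x : ℝ, |x - ⌊x⌋| ≤ 1 := fun x => by
    rw [Int.self_sub_floor, abs_of_nonneg (Int.fract_nonneg x)]
    exact (Int.fract_lt_one x).le
  obtain ⟨x, y, z⟩ := p
  refine ⟨(⌊r⁻¹ * x⌋, ⌊r⁻¹ * y⌋,
    ⌊r⁻¹ ^ 2 * z - (r⁻¹ * x - ⌊r⁻¹ * x⌋) * ⌊r⁻¹ * y⌋⌋), norm_le_iff.2 ⟨?_, ?_, ?_⟩⟩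
  · convert key (r⁻¹ * x) using 2
    simp only [chart, mul, dilate, inv]
    ring
  · convert key (r⁻¹ * y) using 2
    simp only [chart, mul, dilate, inv]
    ring
  · convert key (r⁻¹ ^ 2 * z - (r⁻¹ * x - ⌊r⁻¹ * x⌋) * ⌊r⁻¹ * y⌋) using 2
    simp only [chart, mul, dilate, inv]
    ring

lemma exists_chart_eq_zero {r : ℝ} (hr : 0 < r) (γ : ℤ × ℤ × ℤ) : ∃ c, chart r γ c = 0 := by
  refine ⟨dilate r ((γ.1 : ℝ), (γ.2.1 : ℝ), (γ.2.2 : ℝ)), ?_⟩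
  have h : r⁻¹ * r = 1 := inv_mul_cancel₀ hr.ne'
  refine Prod.ext ?_ (Prod.ext ?_ ?_) <;>
    simp only [chart, mul, dilate, inv, Prod.fst_zero, Prod.snd_zero, ← mul_assoc, ← mul_pow, h] <;>
    ring

/-- The enlarged tile of scale `r` has diameter less than `35 * r`. -/
lemma exists_path_of_norm_chart_le {r : ℝ} (hr : 0 < r) {γ : ℤ × ℤ × ℤ} {p q : H}
    (hp : ‖chart r γ p‖ ≤ 2) (hq : ‖chart r γ q‖ ≤ 2) :
    ∃ l, applyFlows l p = q ∧ pathLength l ≤ 34 * r := by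
  rw [norm_le_iff] at hp hq
  set u := chart r γ p with hu
  set v := chart r γ q with hv
  obtain ⟨p1, p2, p3⟩ := hp
  obtain ⟨q1, q2, q3⟩ := hq
  have h : r * r⁻¹ = 1 := mul_inv_cancel₀ hr.ne'
  have e1 : q.1 - p.1 = r * (v.1 - u.1) := by
    simp only [hu, hv, chart, mul, dilate, inv]
    linear_combination (p.1 - q.1) * h
  have e2 : q.2.1 - p.2.1 = r * (v.2.1 - u.2.1) := by
    simp only [hu, hv, chart, mul, dilate, inv]
    linear_combination (p.2.1 - q.2.1) * h
  have e3 : q.2.2 - p.2.2 - (q.1 - p.1) * p.2.1 =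
      r ^ 2 * (v.2.2 - u.2.2 - (v.1 - u.1) * u.2.1) := by
    simp only [hu, hv, chart, mul, dilate, inv]
    linear_combination (-(q.2.2 - p.2.2 - (q.1 - p.1) * p.2.1)) * (r * r⁻¹ + 1) * h
  have d1 := (abs_sub v.1 u.1).trans (add_le_add q1 p1)
  have d2 := (abs_sub v.2.1 u.2.1).trans (add_le_add q2 p2)
  have d3 := (abs_sub v.2.2 u.2.2).trans (add_le_add q3 p3)
  have d4 : |(v.1 - u.1) * u.2.1| ≤ (2 + 2) * 2 := by
    rw [abs_mul]
    exact mul_le_mul d1 p2 (abs_nonneg _) (by norm_num)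
  obtain ⟨l, hl, hl'⟩ := exists_path_le (p := p) (q := q) (a := 4) (b := 12) hr
    (by rw [e1, abs_mul, abs_of_pos hr]; gcongr; linarith)
    (by rw [e2, abs_mul, abs_of_pos hr]; gcongr; linarith)
    (by
      rw [e3, abs_mul, abs_of_pos (pow_pos hr 2)]
      gcongr
      exact (abs_sub _ _).trans (by linarith))
  exact ⟨l, hl, hl'.trans (by linarith)⟩

/-- The enlarged tiles of two lattice points that are congruent modulo `N` are far apart. -/
lemma eq_of_norm_chart_le {r : ℝ} (hr : 0 < r) {N : ℕ} (hN : 6000 ≤ N) {γ γ' : ℤ × ℤ × ℤ}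
    (h1 : (γ.1 : ZMod N) = γ'.1) (h2 : (γ.2.1 : ZMod N) = γ'.2.1)
    (h3 : (γ.2.2 : ZMod N) = γ'.2.2) {p : H} {l : List (Bool × ℝ)} (hl : pathLength l ≤ 70 * r)
    (hp : ‖chart r γ p‖ ≤ 2) (hq : ‖chart r γ' (applyFlows l p)‖ ≤ 2) : γ = γ' := by
  have key : ∀ {a b : ℤ}, (a : ZMod N) = b → |(b : ℝ) - a| ≤ 5100 → a = b := by
    intro a b hab h
    rw [ZMod.intCast_eq_intCast_iff_dvd_sub] at hab
    have h' : |b - a| ≤ 5100 := by exact_mod_cast h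
    have := Int.eq_zero_of_abs_lt_dvd hab (by lia)
    lia
  obtain ⟨d1, d2, d3⟩ := applyFlows_displacement l p
  have hl0 := pathLength_nonneg l
  generalize applyFlows l p = q at *
  rw [norm_le_iff] at hp hq
  set u := chart r γ p with hu
  set v := chart r γ' q with hv
  obtain ⟨p1, p2, p3⟩ := hp
  obtain ⟨q1, q2, q3⟩ := hq
  have hi : 0 < r⁻¹ := inv_pos.2 hr
  have h : r⁻¹ * r = 1 := inv_mul_cancel₀ hr.ne'
  have f1 : |r⁻¹ * (q.1 - p.1)| ≤ 70 := by
    rw [abs_mul, abs_of_pos hi, inv_mul_le_iff₀ hr]; linarith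
  have f2 : |r⁻¹ * (q.2.1 - p.2.1)| ≤ 70 := by
    rw [abs_mul, abs_of_pos hi, inv_mul_le_iff₀ hr]; linarith
  have f3 : |r⁻¹ ^ 2 * (q.2.2 - p.2.2 - (q.1 - p.1) * p.2.1)| ≤ 4900 := by
    rw [abs_mul, abs_of_pos (pow_pos hi 2), inv_pow, inv_mul_le_iff₀ (pow_pos hr 2)]
    nlinarith
  have e1 : γ.1 = γ'.1 := by
    refine key h1 ?_
    have : (γ'.1 : ℝ) - γ.1 = r⁻¹ * (q.1 - p.1) - (v.1 - u.1) := by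
      simp only [hu, hv, chart, mul, dilate, inv]
      ring
    rw [this]
    have := abs_sub v.1 u.1
    exact (abs_sub _ _).trans (by linarith)
  have e2 : γ.2.1 = γ'.2.1 := by
    refine key h2 ?_
    have : (γ'.2.1 : ℝ) - γ.2.1 = r⁻¹ * (q.2.1 - p.2.1) - (v.2.1 - u.2.1) := by
      simp only [hu, hv, chart, mul, dilate, inv]
      ring
    rw [this]
    have := abs_sub v.2.1 u.2.1
    exact (abs_sub _ _).trans (by linarith)
  refine Prod.ext e1 (Prod.ext e2 (key h3 ?_))
  have : (γ'.2.2 : ℝ) - γ.2.2 = r⁻¹ ^ 2 * (q.2.2 - p.2.2 - (q.1 - p.1) * p.2.1) +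
      r⁻¹ * (q.1 - p.1) * u.2.1 - (v.2.2 - u.2.2) := by
    simp only [hu, hv, chart, mul, dilate, inv, e1, e2]
    ring
  rw [this]
  have g1 : |r⁻¹ * (q.1 - p.1) * u.2.1| ≤ 70 * 2 := by
    rw [abs_mul]
    exact mul_le_mul f1 p2 (abs_nonneg _) (by norm_num)
  have g2 := abs_sub v.2.2 u.2.2
  have g3 := (abs_add_le _ _).trans (add_le_add f3 g1)
  exact (abs_sub _ _).trans (by linarith)

end Chart
lemma HasFlowDeriv.norm_applyFlows_sub_le {E : Type*} [NormedAddCommGroup E] [NormedSpace ℝ E]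
    {u : H → E} {u' : Bool → H → E} (hu : HasFlowDeriv u u') {M s : ℝ} (hM : 0 ≤ M)
    {p : H} (h : ∀ b l, ‖u' b (applyFlows l p)‖ ≤ M * (s + pathLength l))
    (l : List (Bool × ℝ)) :
    ‖u (applyFlows l p) - u p‖ ≤ M * (s + pathLength l) * pathLength l := by
  induction l with
  | nil => simp [applyFlows]
  | cons wt l ih =>
    obtain ⟨b, t⟩ := wt
    have hl := pathLength_nonneg l
    have hstep : ‖u (flow b t (applyFlows l p)) - u (applyFlows l p)‖ ≤
        M * (s + (|t| + pathLength l)) * |t| := by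
      refine hu.norm_flow_sub_le fun τ hτ => (h b ((b, τ) :: l)).trans ?_
      rw [pathLength_cons]
      gcongr
    rw [pathLength_cons]
    calc ‖u (flow b t (applyFlows l p)) - u p‖
        ≤ ‖u (flow b t (applyFlows l p)) - u (applyFlows l p)‖ + ‖u (applyFlows l p) - u p‖ :=
          norm_sub_le_norm_sub_add_norm_sub _ _ _
      _ ≤ M * (s + (|t| + pathLength l)) * |t| + M * (s + pathLength l) * pathLength l :=
          add_le_add hstep ih
      _ ≤ M * (s + (|t| + pathLength l)) * |t| +
          M * (s + (|t| + pathLength l)) * pathLength l := by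
          gcongr
          linarith [abs_nonneg t]
      _ = _ := by ring

lemma norm_sum_le_of_eq_zero {ι E : Type*} [NormedAddCommGroup E] {F T : Finset ι} {v : ι → E}
    {n : ℕ} {B : ℝ} (hB : 0 ≤ B) (hv : ∀ i ∈ F, ‖v i‖ ≤ B) (hT : ∀ i ∈ F, v i ≠ 0 → i ∈ T)
    (hn : T.card ≤ n) : ‖∑ i ∈ F, v i‖ ≤ n * B := by
  classical
  rw [← Finset.sum_filter_ne_zero]
  refine (norm_sum_le_of_le _ fun i hi => hv i (Finset.mem_filter.1 hi).1).trans ?_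
  rw [Finset.sum_const, nsmul_eq_mul]
  gcongr
  refine (Finset.card_le_card fun i hi => ?_).trans hn
  rw [Finset.mem_filter] at hi
  exact hT i hi.1 hi.2

/-- The enlarged tiles of scale `r` indexed by `F` are pairwise at distance at least `70 * r`. -/
def Separated (r : ℝ) (F : Finset (ℤ × ℤ × ℤ)) : Prop :=
  ∀ γ ∈ F, ∀ γ' ∈ F, ∀ p l, pathLength l ≤ 70 * r → ‖chart r γ p‖ ≤ 2 →
    ‖chart r γ' (applyFlows l p)‖ ≤ 2 → γ = γ'

lemma Separated.eq {r : ℝ} {F : Finset (ℤ × ℤ × ℤ)} (h : Separated r F) (hr : 0 ≤ r)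
    {γ γ' : ℤ × ℤ × ℤ} (hγ : γ ∈ F) (hγ' : γ' ∈ F) {p : H} (hp : ‖chart r γ p‖ ≤ 2)
    (hp' : ‖chart r γ' p‖ ≤ 2) : γ = γ' :=
  h γ hγ γ' hγ' p [] (by rw [pathLength_nil]; positivity) hp hp'

section TileSum

variable {E : Type*} [NormedAddCommGroup E] [InnerProductSpace ℝ E]

/-- Superposition of copies of `χ` on the tiles of scale `r` indexed by `F`, pointing in the
directions `e`. -/
def tileSum (r : ℝ) (F : Finset (ℤ × ℤ × ℤ)) (e : ℤ × ℤ × ℤ → E) (χ : H → ℝ) (p : H) : E :=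
  ∑ γ ∈ F, χ (chart r γ p) • e γ

variable {r K : ℝ} {F : Finset (ℤ × ℤ × ℤ)} {e : ℤ × ℤ × ℤ → E} {χ : H → ℝ}

lemma tileSum_eq_of_norm_chart_le (hr : 0 ≤ r) (hF : Separated r F)
    (hχ : ∀ p, χ p ≠ 0 → ‖p‖ ≤ 2) {γ : ℤ × ℤ × ℤ} (hγ : γ ∈ F) {p : H}
    (hp : ‖chart r γ p‖ ≤ 2) : tileSum r F e χ p = χ (chart r γ p) • e γ := by
  refine Finset.sum_eq_single_of_mem γ hγ fun γ' hγ' hne => ?_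
  by_cases h : χ (chart r γ' p) = 0
  · rw [h, zero_smul]
  · exact absurd (hF.eq hr hγ' hγ (hχ _ h) hp) hne

lemma tileSum_eq_zero (hχ : ∀ p, χ p ≠ 0 → ‖p‖ ≤ 2) {p : H}
    (hp : ∀ γ ∈ F, 2 < ‖chart r γ p‖) : tileSum r F e χ p = 0 := by
  refine Finset.sum_eq_zero fun γ hγ => ?_
  by_cases h : χ (chart r γ p) = 0
  · rw [h, zero_smul]
  · exact absurd (hχ _ h) (hp γ hγ).not_ge

lemma norm_tileSum_le (hr : 0 ≤ r) (hF : Separated r F) (he : ∀ γ, ‖e γ‖ = 1)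
    (hχ : ∀ p, χ p ≠ 0 → ‖p‖ ≤ 2) (hK : ∀ p, |χ p| ≤ K) (p : H) : ‖tileSum r F e χ p‖ ≤ K := by
  by_cases h : ∃ γ ∈ F, ‖chart r γ p‖ ≤ 2
  · obtain ⟨γ, hγ, hp⟩ := h
    rw [tileSum_eq_of_norm_chart_le hr hF hχ hγ hp, norm_smul, he, mul_one]
    exact hK _
  · push Not at h
    rw [tileSum_eq_zero hχ h, norm_zero]
    exact (abs_nonneg _).trans (hK 0)

lemma flowLipschitz_tileSum (hr : 0 < r) (hF : Separated r F) (he : ∀ γ, ‖e γ‖ = 1)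
    (hχ : ∀ p, χ p ≠ 0 → ‖p‖ ≤ 2) (hK0 : 0 ≤ K) (hK : FlowLipschitz K χ) :
    FlowLipschitz (2 * K / r) (tileSum r F e χ) := by
  classical
  intro b t p
  have card : ∀ q, (F.filter fun γ => ‖chart r γ q‖ ≤ 2).card ≤ 1 := fun q =>
    Finset.card_le_one.2 fun γ hγ γ' hγ' => by
      rw [Finset.mem_filter] at hγ hγ'
      exact hF.eq hr.le hγ.1 hγ'.1 hγ.2 hγ'.2
  rw [tileSum, tileSum, ← Finset.sum_sub_distrib]
  refine (norm_sum_le_of_eq_zero (B := K / r * |t|) (n := 2)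
    (T := (F.filter fun γ => ‖chart r γ (flow b t p)‖ ≤ 2) ∪ F.filter fun γ => ‖chart r γ p‖ ≤ 2)
    (by positivity) ?_ ?_ ((Finset.card_union_le _ _).trans
      (add_le_add (card _) (card _)))).trans (le_of_eq (by push_cast; ring))
  · intro γ _
    rw [← sub_smul, norm_smul, he, mul_one, chart_flow]
    refine (hK b _ _).trans (le_of_eq ?_)
    rw [abs_mul, abs_of_pos (inv_pos.2 hr)]
    ring
  · intro γ hγ hne
    rw [Finset.mem_union, Finset.mem_filter, Finset.mem_filter]
    by_contra! hcon
    refine hne ?_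
    have z : ∀ q, (γ ∈ F → 2 < ‖chart r γ q‖) → χ (chart r γ q) = 0 := fun q hq => by
      by_contra h
      exact (hχ _ h).not_gt (hq hγ)
    rw [z _ hcon.1, z _ hcon.2, sub_self]

lemma hasFlowDeriv_tileSum {χ' : Bool → H → ℝ} (hr : r ≠ 0) (hχ : HasFlowDeriv χ χ') :
    HasFlowDeriv (fun p => r • tileSum r F e χ p) fun b => tileSum r F e (χ' b) := by
  intro b p
  have h : ∀ γ ∈ F, HasDerivAt (fun t => χ (chart r γ (flow b t p)) • e γ)
      ((r⁻¹ * χ' b (chart r γ p)) • e γ) 0 := fun γ _ => by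
    have h1 := hχ.hasDerivAt b (chart r γ p) (r⁻¹ * 0)
    have h2 := h1.comp 0 ((hasDerivAt_id (0 : ℝ)).const_mul r⁻¹)
    rw [mul_zero, flow_zero, mul_one, mul_comm] at h2
    simp only [chart_flow]
    exact h2.smul_const (e γ)
  have h3 := (HasDerivAt.fun_sum h).fun_const_smul r
  rw [Finset.smul_sum] at h3
  simpa only [tileSum, smul_smul, mul_inv_cancel_left₀ hr] using h3

end TileSum

section Iteration

variable {E : Type*} [NormedAddCommGroup E] [InnerProductSpace ℝ E]

lemma FlowLipschitz.abs_inner_le {f : H → E} {M s : ℝ} (hM : 0 ≤ M) (hf : FlowLipschitz M f)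
    {e : E} (he : ‖e‖ = 1) {c : H} (hc : ⟪e, f c⟫ = 0) {l : List (Bool × ℝ)}
    (hl : pathLength l ≤ s) : |⟪e, f (applyFlows l c)⟫| ≤ M * s := by
  rw [← sub_zero ⟪e, _⟫, ← hc, ← inner_sub_right]
  refine (abs_real_inner_le_norm _ _).trans ?_
  rw [he, one_mul]
  exact (hf.norm_applyFlows_sub_le l c).trans (by gcongr)

/-- Adding a new scale: a map with slowly varying horizontal gradient can be perturbed at scale `r`
so that points in the tiles of `F` get separated from points at distance comparable to `r`, at a
bounded cost in the square of the gradient. -/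
lemma exists_perturbation (hE : ∀ v w : E, ∃ e : E, ‖e‖ = 1 ∧ ⟪e, v⟫ = 0 ∧ ⟪e, w⟫ = 0)
    {K : ℝ} {χ : H → ℝ} {χ' : Bool → H → ℝ} (hχ : IsBump K χ χ') {f : H → E} {f' : Bool → H → E}
    {M S r : ℝ} (hf : HasFlowDeriv f f') (hM : 0 ≤ M) (hf' : ∀ b, FlowLipschitz M (f' b))
    (hS : ∀ b p, ‖f' b p‖ ^ 2 ≤ S) (hr : 0 < r) (hMr : M * r ≤ 1 / 30000)
    {F : Finset (ℤ × ℤ × ℤ)} (hF : Separated r F) :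
    ∃ (g : H → E) (g' : Bool → H → E), HasFlowDeriv g g' ∧
      (∀ b, FlowLipschitz (M + 2 * K / r) (g' b)) ∧ (∀ b p, ‖g' b p‖ ^ 2 ≤ S + 3 * K ^ 2) ∧
      (∀ p, ‖g p - f p‖ ≤ K * r) ∧
      ∀ γ ∈ F, ∀ p l, ‖chart r γ p‖ ≤ 1 → pathLength l ≤ 70 * r →
        2 < ‖chart r γ (applyFlows l p)‖ → 3 / 4 * r ≤ ‖g p - g (applyFlows l p)‖ := by
  have hK := hχ.one_le
  choose c hc using fun γ => exists_chart_eq_zero hr γ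
  choose e he he1 he2 using fun γ => hE (f' true (c γ)) (f' false (c γ))
  have hce : ∀ γ b, ⟪e γ, f' b (c γ)⟫ = 0 := fun γ b => by
    cases b
    exacts [he2 γ, he1 γ]
  have hpath : ∀ γ p, ‖chart r γ p‖ ≤ 2 → ∃ l, applyFlows l (c γ) = p ∧ pathLength l ≤ 34 * r :=
    fun γ p hp => exists_path_of_norm_chart_le hr (by simp [hc γ]) hp
  have hinner : ∀ γ b p, ‖chart r γ p‖ ≤ 2 → |⟪e γ, f' b p⟫| ≤ M * (34 * r) := by
    intro γ b p hp
    obtain ⟨l, rfl, hl⟩ := hpath γ p hp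
    exact (hf' b).abs_inner_le hM (he γ) (hce γ b) hl
  refine ⟨fun p => f p + r • tileSum r F e χ p, fun b p => f' b p + tileSum r F e (χ' b) p,
    fun b p => (hf b p).add (hasFlowDeriv_tileSum hr.ne' hχ.hasFlowDeriv b p), ?_, ?_, ?_, ?_⟩
  · intro b b' t p
    rw [add_sub_add_comm, add_mul]
    exact (norm_add_le _ _).trans (add_le_add (hf' b b' t p)
      (flowLipschitz_tileSum hr hF he (hχ.norm_le_deriv b) (by linarith) (hχ.flowLipschitz b)
        b' t p))
  · intro b p
    have hSp := hS b p
    beta_reduce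
    by_cases h : ∃ γ ∈ F, ‖chart r γ p‖ ≤ 2
    · obtain ⟨γ, hγ, hp⟩ := h
      rw [tileSum_eq_of_norm_chart_le hr.le hF (hχ.norm_le_deriv b) hγ hp]
      set a := χ' b (chart r γ p) with ha
      have haK : |a| ≤ K := hχ.abs_deriv_le b _
      have h1 : |a * ⟪e γ, f' b p⟫| ≤ K * 1 := by
        rw [abs_mul]
        exact mul_le_mul haK ((hinner γ b p hp).trans (by linarith)) (abs_nonneg _) (by linarith)
      have h2 := (abs_le.1 h1).2
      have h3 : a ^ 2 ≤ K ^ 2 := sq_le_sq' (abs_le.1 haK).1 (abs_le.1 haK).2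
      rw [norm_add_sq_real, real_inner_smul_right, real_inner_comm, norm_smul, he, mul_one,
        Real.norm_eq_abs, sq_abs]
      nlinarith
    · push Not at h
      rw [tileSum_eq_zero (hχ.norm_le_deriv b) h, add_zero]
      nlinarith
  · intro p
    rw [add_sub_cancel_left, norm_smul, Real.norm_eq_abs, abs_of_pos hr, mul_comm]
    gcongr
    exact norm_tileSum_le hr.le hF he hχ.norm_le hχ.abs_le p
  · intro γ hγ p l hp hl hq
    have hp2 : ‖chart r γ p‖ ≤ 2 := hp.trans (by norm_num)
    have hq0 : tileSum r F e χ (applyFlows l p) = 0 := by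
      refine tileSum_eq_zero hχ.norm_le fun γ' hγ' => ?_
      by_contra! hcon
      rw [← hF γ hγ γ' hγ' p l hl hp2 hcon] at hcon
      exact hcon.not_gt hq
    have hu : HasFlowDeriv (fun x => ⟪e γ, f x⟫) fun b x => ⟪e γ, f' b x⟫ := fun b x => by
      have := (hasDerivAt_const (0 : ℝ) (e γ)).inner ℝ (hf b x)
      simpa using this
    have hbound : |⟪e γ, f (applyFlows l p) - f p⟫| ≤
        M * (34 * r + pathLength l) * pathLength l := by
      rw [inner_sub_right]
      refine hu.norm_applyFlows_sub_le hM (fun b l' => ?_) l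
      rw [mul_add, ← add_sub_cancel (f' b p) (f' b (applyFlows l' p)), inner_add_right]
      refine (norm_add_le _ _).trans (add_le_add (hinner γ b p hp2) ?_)
      refine (abs_real_inner_le_norm _ _).trans ?_
      rw [he, one_mul]
      exact (hf' b).norm_applyFlows_sub_le l' p
    have hsmall : M * (34 * r + pathLength l) * pathLength l ≤ 1 / 4 * r := by
      have hl0 := pathLength_nonneg l
      calc M * (34 * r + pathLength l) * pathLength l
          ≤ M * (34 * r + 70 * r) * (70 * r) := by gcongr
        _ = 7280 * (M * r) * r := by ring
        _ ≤ 7280 * (1 / 30000) * r := by gcongr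
        _ ≤ _ := by linarith
    beta_reduce
    rw [tileSum_eq_of_norm_chart_le hr.le hF hχ.norm_le hγ hp2, hq0, hχ.eq_one _ hp, one_smul,
      smul_zero, add_zero]
    have h1 : ⟪e γ, f p + r • e γ - f (applyFlows l p)⟫ =
        r - ⟪e γ, f (applyFlows l p) - f p⟫ := by
      rw [inner_sub_right, inner_sub_right, inner_add_right, real_inner_smul_right,
        real_inner_self_eq_norm_sq, he]
      ring
    have h2 := real_inner_le_norm (e γ) (f p + r • e γ - f (applyFlows l p))
    rw [he, one_mul, h1] at h2
    have := (abs_le.1 hbound).2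
    linarith

/-- Superposition of the scales `ρ / A ^ j`, `j < n`. -/
lemma exists_multiscale_map (hE : ∀ v w : E, ∃ e : E, ‖e‖ = 1 ∧ ⟪e, v⟫ = 0 ∧ ⟪e, w⟫ = 0)
    {K : ℝ} {χ : H → ℝ} {χ' : Bool → H → ℝ} (hχ : IsBump K χ χ') {A ρ : ℝ} (hA : 120000 * K ≤ A)
    (hρ : 0 < ρ) (F : ℕ → Finset (ℤ × ℤ × ℤ)) (hF : ∀ j, Separated (ρ / A ^ j) (F j)) (n : ℕ) :
    ∃ (f : H → E) (f' : Bool → H → E), HasFlowDeriv f f' ∧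
      (∀ b, FlowLipschitz (4 * K / (A * (ρ / A ^ n))) (f' b)) ∧
      (∀ b p, ‖f' b p‖ ^ 2 ≤ n * (3 * K ^ 2)) ∧
      ∀ j < n, ∀ γ ∈ F j, ∀ p l, ‖chart (ρ / A ^ j) γ p‖ ≤ 1 → pathLength l ≤ 70 * (ρ / A ^ j) →
        2 < ‖chart (ρ / A ^ j) γ (applyFlows l p)‖ →
          1 / 2 * (ρ / A ^ j) + 4 * K * (ρ / A ^ n) ≤ ‖f p - f (applyFlows l p)‖ := by
  have hK := hχ.one_le
  have hA0 : 0 < A := by linarith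
  induction n with
  | zero =>
    refine ⟨0, 0, fun b p => hasDerivAt_const _ _, fun b b' t p => ?_, by simp, by simp⟩
    simp only [Pi.zero_apply, sub_self, norm_zero]
    positivity
  | succ n ih =>
    obtain ⟨f, f', hf, hf', hS, hlow⟩ := ih
    set r := ρ / A ^ n with hr
    have hr0 : 0 < r := by positivity
    have hr' : ρ / A ^ (n + 1) = r / A := by rw [hr, pow_succ, div_div]
    have hArA : A * (r / A) = r := by field_simp
    have hle : r / A ≤ 1 / 16 * r / K := by
      rw [div_le_div_iff₀ hA0 (by linarith)]
      nlinarith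
    have hle' : 4 * K * (r / A) ≤ 1 / 4 * r := by
      calc 4 * K * (r / A) ≤ 4 * K * (1 / 16 * r / K) := by gcongr
        _ = 1 / 4 * r := by field_simp; norm_num
    have hMr : 4 * K / (A * r) * r ≤ 1 / 30000 := by
      rw [div_mul_eq_mul_div, div_le_div_iff₀ (by positivity) (by norm_num)]
      nlinarith
    obtain ⟨g, g', hg, hg', hgS, hgf, hglow⟩ :=
      exists_perturbation hE hχ hf (by positivity) hf' hS hr0 hMr (hF n)
    rw [hr', hArA]
    refine ⟨g, g', hg, fun b => (hg' b).mono ?_, fun b p => (hgS b p).trans ?_, ?_⟩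
    · have : 4 * K / (A * r) ≤ 2 * K / r := by
        rw [div_le_div_iff₀ (by positivity) hr0]
        nlinarith [mul_pos (show 0 < K by linarith) hr0]
      calc 4 * K / (A * r) + 2 * K / r ≤ 2 * K / r + 2 * K / r := by gcongr
        _ = 4 * K / r := by ring
    · push_cast
      linarith
    · intro j hj γ hγ p l hp hl hq
      rcases Nat.lt_succ_iff_lt_or_eq.1 hj with hj | rfl
      · have h1 := hlow j hj γ hγ p l hp hl hq
        have h2 := hgf p
        have h3 := hgf (applyFlows l p)
        have h4 : ‖f p - f (applyFlows l p)‖ ≤ ‖g p - g (applyFlows l p)‖ + ‖g p - f p‖ +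
            ‖g (applyFlows l p) - f (applyFlows l p)‖ := by
          calc ‖f p - f (applyFlows l p)‖ = ‖(g p - g (applyFlows l p)) - (g p - f p) +
              (g (applyFlows l p) - f (applyFlows l p))‖ := by congr 1; abel
            _ ≤ _ := (norm_add_le _ _).trans (add_le_add_left (norm_sub_le _ _) _)
        nlinarith
      · have := hglow γ hγ p l hp hl hq
        rw [← hr]
        linarith

end Iteration
lemma exists_unit_orthogonal_pair (v w : EuclideanSpace ℝ (Fin 3)) :
    ∃ e : EuclideanSpace ℝ (Fin 3), ‖e‖ = 1 ∧ ⟪e, v⟫ = 0 ∧ ⟪e, w⟫ = 0 := by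
  set U := Submodule.span ℝ ({v, w} : Set (EuclideanSpace ℝ (Fin 3))) with hU
  have hne : Uᗮ ≠ ⊥ := by
    intro h
    rw [Submodule.orthogonal_eq_bot_iff] at h
    have h1 : Module.finrank ℝ U ≤ 2 := by
      classical
      have := finrank_span_finset_le_card (R := ℝ) ({v, w} : Finset (EuclideanSpace ℝ (Fin 3)))
      rw [Finset.coe_pair] at this
      exact this.trans Finset.card_le_two
    rw [h, finrank_top, finrank_euclideanSpace_fin] at h1
    lia
  obtain ⟨x, hx, hx0⟩ := Submodule.exists_mem_ne_zero_of_ne_bot hne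
  have key : ∀ y ∈ ({v, w} : Set (EuclideanSpace ℝ (Fin 3))), ⟪‖x‖⁻¹ • x, y⟫ = 0 := fun y hy => by
    rw [real_inner_smul_left, real_inner_comm,
      Submodule.inner_right_of_mem_orthogonal (Submodule.subset_span hy) hx, mul_zero]
  exact ⟨‖x‖⁻¹ • x, norm_smul_inv_norm hx0, key v (by simp), key w (by simp)⟩

/-- A lattice point whose tile of scale `r` contains `p`. -/
def tile (r : ℝ) (p : H) : ℤ × ℤ × ℤ := (exists_norm_chart_le_one r p).choose

lemma norm_chart_tile_le (r : ℝ) (p : H) : ‖chart r (tile r p) p‖ ≤ 1 :=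
  (exists_norm_chart_le_one r p).choose_spec

/-- The residue class modulo `N` of a lattice point. -/
def residue (N : ℕ) (γ : ℤ × ℤ × ℤ) : ZMod N × ZMod N × ZMod N := (γ.1, γ.2.1, γ.2.2)

/-- For each residue class `κ`, a map that is `O(√n)`-Lipschitz and separates at the right scale
the points whose tile has residue class `κ`. -/
lemma exists_map_of_residue {K : ℝ} {χ : H → ℝ} {χ' : Bool → H → ℝ} (hχ : IsBump K χ χ')
    {A ρ : ℝ} (hA : 120000 * K ≤ A) (hρ : 0 < ρ) {N : ℕ} (hN : 6000 ≤ N) (S : Finset H) (n : ℕ)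
    (κ : ZMod N × ZMod N × ZMod N) :
    ∃ f : H → EuclideanSpace ℝ (Fin 3),
      (∀ p q, ‖f p - f q‖ ≤ √(n * (3 * K ^ 2)) * ccDist p q) ∧
      ∀ j < n, ∀ p ∈ S, residue N (tile (ρ / A ^ j) p) = κ → ∀ q,
        35 * (ρ / A ^ j) ≤ ccDist p q → ccDist p q < 70 * (ρ / A ^ j) →
          1 / 2 * (ρ / A ^ j) ≤ ‖f p - f q‖ := by
  classical
  have hK := hχ.one_le
  have hA0 : 0 < A := by linarith
  have hr : ∀ j : ℕ, 0 < ρ / A ^ j := fun j => by positivity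
  obtain ⟨f, f', hf, -, hS, hlow⟩ := exists_multiscale_map exists_unit_orthogonal_pair hχ hA hρ
    (fun j => (S.image (tile (ρ / A ^ j))).filter fun γ => residue N γ = κ)
    (fun j γ hγ γ' hγ' p l hl hp hq => by
      have h := (Finset.mem_filter.1 hγ).2.trans (Finset.mem_filter.1 hγ').2.symm
      simp only [residue, Prod.mk.injEq] at h
      exact eq_of_norm_chart_le (hr j) hN h.1 h.2.1 h.2.2 hl hp hq) n
  refine ⟨f, (hf.flowLipschitz fun b p => Real.le_sqrt_of_sq_le (hS b p)).norm_sub_le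
    (Real.sqrt_nonneg _), fun j hj p hp hκ q hq hq' => ?_⟩
  obtain ⟨l, rfl, hl⟩ := exists_path_lt hq'
  have hp1 := norm_chart_tile_le (ρ / A ^ j) p
  have := hlow j hj _ (Finset.mem_filter.2 ⟨Finset.mem_image_of_mem _ hp, hκ⟩) p l hp1 hl.le (by
    by_contra! hcon
    obtain ⟨l', hl', hlen⟩ := exists_path_of_norm_chart_le (hr j) (hp1.trans one_le_two) hcon
    have h := ccDist_le_pathLength l' p
    rw [hl'] at h
    linarith [hr j])
  have := hr n
  have : 0 ≤ 4 * K * (ρ / A ^ n) := by positivity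
  linarith

/-- A finite family of maps into `ℝ³` can be combined into a single map. -/
lemma exists_combined_map (ι : Type*) [Fintype ι] : ∃ D : ℕ,
    ∀ f : ι → H → EuclideanSpace ℝ (Fin 3), ∃ Φ : H → EuclideanSpace ℝ (Fin D),
      ∀ p q, ‖Φ p - Φ q‖ ^ 2 = ∑ i, ‖f i p - f i q‖ ^ 2 := by
  refine ⟨Fintype.card (ι × Fin 3), fun f => ?_⟩
  let e := (Fintype.equivFin (ι × Fin 3)).symm
  refine ⟨fun p => WithLp.toLp 2 fun k => f (e k).1 p (e k).2, fun p q => ?_⟩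
  simp only [EuclideanSpace.norm_sq_eq, PiLp.sub_apply]
  rw [e.sum_comp (fun x : ι × Fin 3 => ‖f x.1 p x.2 - f x.1 q x.2‖ ^ 2), Fintype.sum_prod_type]

lemma exists_two_pow_gt {R : ℝ} (hR : 2 ≤ R) :
    ∃ n : ℕ, 0 < n ∧ 28 * R < 2 ^ n ∧ (n : ℝ) ≤ 14 * Real.log R := by
  obtain ⟨m, hm, hm'⟩ := exists_nat_pow_near (x := 28 * R) (by linarith) one_lt_two
  refine ⟨m + 1, m.succ_pos, hm', ?_⟩
  have h1 : (2 : ℝ) ^ (m + 1) ≤ R ^ 7 := by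
    have : (2 : ℝ) ^ 6 ≤ R ^ 6 := by gcongr
    rw [pow_succ, pow_succ R 6]
    nlinarith
  have h2 := Real.log_le_log (by positivity) h1
  rw [Real.log_pow, Real.log_pow] at h2
  have h3 := Real.log_two_gt_d9
  have h4 : (0 : ℝ) ≤ (m + 1 : ℕ) := Nat.cast_nonneg _
  push_cast at h2 h4 ⊢
  nlinarith

end Heisenberg

/-- **Embedding discrete balls of the integer Heisenberg lattice with optimal distortion.**
There exist a dimension `D` and an absolute `K ≥ 1` such that for every `R ≥ 2` the ball
`B_Γ(0,R)` embeds into `ℝ^D` with distortion `K·(log R)^{1/2}`. -/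
theorem statement1 :
    ∃ (D : ℕ) (K : ℝ), 1 ≤ K ∧
      ∀ R : ℝ, 2 ≤ R →
        ∃ (Φ : H → EuclideanSpace ℝ (Fin D)) (c : ℝ), 0 < c ∧
          ∀ γ γ' : H, inGamma γ → inGamma γ' →
            ccDist 0 γ < R → ccDist 0 γ' < R →
              c * ccDist γ γ' ≤ ‖Φ γ - Φ γ'‖ ∧
              ‖Φ γ - Φ γ'‖ ≤ c * K * Real.sqrt (Real.log R) * ccDist γ γ' := by
  obtain ⟨K, χ, χ', hχ⟩ := exists_isBump
  have hK := hχ.one_le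
  obtain ⟨L, hL⟩ := pow_unbounded_of_one_lt (120000 * K) (one_lt_two (α := ℝ))
  have hL0 : 0 < L := by
    rcases Nat.eq_zero_or_pos L with rfl | h
    · norm_num at hL
      linarith
    · exact h
  obtain ⟨N, hN⟩ : ∃ N : ℕ, 6000 ≤ N := ⟨6000, le_rfl⟩
  have : NeZero N := ⟨by lia⟩
  obtain ⟨D, hD⟩ := exists_combined_map (Fin L × ZMod N × ZMod N × ZMod N)
  set m : ℝ := (Fintype.card (Fin L × ZMod N × ZMod N × ZMod N) : ℝ) with hm
  set B : ℝ := m * (42 * K ^ 2) with hB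
  refine ⟨D, 140 * √B + 1, by linarith [Real.sqrt_nonneg B], fun R hR => ?_⟩
  obtain ⟨n, hn0, hn, hnlog⟩ := exists_two_pow_gt hR
  choose f hfL hf using fun i : Fin L × ZMod N × ZMod N × ZMod N =>
    exists_map_of_residue hχ hL.le
      (show (0 : ℝ) < 2 ^ (i.1 : ℕ) * (2 ^ L) ^ (n - 1) / 70 by positivity) hN
      (finite_ball R).toFinset n i.2
  obtain ⟨Φ, hΦ⟩ := hD f
  refine ⟨Φ, 1 / 140, by norm_num, fun p q hp hq hpR hqR => ⟨?_, ?_⟩⟩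
  · by_cases hpq : p = q
    · subst hpq
      have h0 := ccDist_le_pathLength [] p
      rw [applyFlows, pathLength_nil] at h0
      exact (by linarith : 1 / 140 * ccDist p p ≤ 0).trans (norm_nonneg _)
    have hd := half_le_ccDist hp hq hpq
    have hd' := ccDist_le_of_mem_ball hpR hqR
    obtain ⟨i, hi, hi'⟩ := exists_nat_pow_near (x := 2 * ccDist p q) (by linarith)
      (one_lt_two (α := ℝ))
    have hin : i < n := (pow_lt_pow_iff_right₀ (one_lt_two (α := ℝ))).1 (by linarith)
    have hiL : i / L ≤ n - 1 := (Nat.div_le_self i L).trans (by lia)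
    have hscale : (2 : ℝ) ^ (i % L) * (2 ^ L) ^ (n - 1) / 70 / (2 ^ L) ^ (n - 1 - i / L) =
        2 ^ i / 70 := by
      conv_rhs => rw [← Nat.mod_add_div i L, pow_add, pow_mul]
      have : ((2 : ℝ) ^ L) ^ (n - 1) = (2 ^ L) ^ (i / L) * (2 ^ L) ^ (n - 1 - i / L) := by
        rw [← pow_add, Nat.add_sub_cancel' hiL]
      rw [this]
      field_simp
    have h := hf (⟨i % L, Nat.mod_lt i hL0⟩, residue N (tile (2 ^ i / 70) p)) (n - 1 - i / L)
      (by lia) p ((finite_ball R).mem_toFinset.2 ⟨hp, hpR⟩)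
    simp only [hscale] at h
    have h1 := h trivial q (by linarith) (by rw [pow_succ] at hi'; linarith)
    have h2 := hΦ p q
    have h3 := Finset.single_le_sum (f := fun i => ‖f i p - f i q‖ ^ 2)
      (fun i _ => sq_nonneg _) (Finset.mem_univ
        (⟨i % L, Nat.mod_lt i hL0⟩, residue N (tile (2 ^ i / 70) p)))
    rw [← h2] at h3
    have h4 := le_of_sq_le_sq h3 (norm_nonneg _)
    refine le_trans ?_ (h1.trans h4)
    rw [pow_succ] at hi'
    linarith
  · have hd := ccDist_nonneg p q
    have hlog : 0 ≤ Real.log R := Real.log_nonneg (by linarith)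
    have hsq : ‖Φ p - Φ q‖ ^ 2 ≤ B * Real.log R * ccDist p q ^ 2 := by
      rw [hΦ]
      calc ∑ i, ‖f i p - f i q‖ ^ 2 ≤ ∑ i : Fin L × ZMod N × ZMod N × ZMod N,
            (√(n * (3 * K ^ 2)) * ccDist p q) ^ 2 := by
            gcongr with i
            exact hfL i p q
        _ = m * (n * (3 * K ^ 2) * ccDist p q ^ 2) := by
            rw [Finset.sum_const, nsmul_eq_mul, mul_pow, Real.sq_sqrt (by positivity), hm,
              Finset.card_univ]
        _ ≤ m * (14 * Real.log R * (3 * K ^ 2) * ccDist p q ^ 2) := by gcongr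
        _ = _ := by rw [hB]; ring
    have h1 := Real.le_sqrt_of_sq_le hsq
    rw [Real.sqrt_mul (by positivity), Real.sqrt_mul (by positivity), Real.sqrt_sq hd] at h1
    refine h1.trans ?_
    gcongr
    linarith
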